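/- arXiv:1211.2476 — 2 statements merged into one kernel-verified Lean document; each statement's English description precedes it below -/
import Mathlib

section
/- Consider a location-family random utility model on m alternatives: for each j ∈ {1,…,m} there is a measurable probability density f_j : ℝ → [0,∞) with ∫_ℝ f_j = 1, and for a parameter vector θ ∈ ℝ^m and a permutation π of {1,…,m}, the probability of the ranking π is Pr(π|θ) = ∫_{A_π} ∏_{j=1}^m f_j(x_j − θ_j) dx, where A_π = {x ∈ ℝ^m : x_{π(1)} > x_{π(2)} > ⋯ > x_{π(m)}}. If every density f_j is log-concave on ℝ (i.e., f_j(λx+(1−λ)y) ≥ f_j(x)^λ f_j(y)^{1−λ} for all x,y ∈ ℝ and λ ∈ [0,1]), then for every permutation π the function θ ↦ Pr(π|θ) is log-concave on ℝ^m: for all θ, θ′ ∈ ℝ^m and λ ∈ [0,1], Pr(π | λθ+(1−λ)θ′) ≥ Pr(π|θ)^λ · Pr(π|θ′)^{1−λ}. Consequently, for any data D = (π^1,…,π^n) of n rankings, the log-likelihood l(θ;D) = ∑_{i=1}^n log Pr(π^i|θ) is concave in θ wherever it is finite. -/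
open MeasureTheory

/-- The probability that the ranking `π` is realized in a location-family random
utility model with noise densities `f j` and location parameters `θ j`:
the integral over the region `x_{π(1)} > x_{π(2)} > ⋯ > x_{π(m)}` of the joint
density `∏ j, f j (x j - θ j)`. -/
noncomputable def rumProb {m : ℕ} (f : Fin m → ℝ → ℝ) (θ : Fin m → ℝ)
    (π : Equiv.Perm (Fin m)) : ℝ :=
  ∫ x in {x : Fin m → ℝ | ∀ k l : Fin m, k < l → x (π l) < x (π k)},
    ∏ j, f j (x j - θ j)

open scoped ENNReal Pointwise

/-- The one-dimensional Brunn–Minkowski inequality for compact sets. -/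
theorem IsCompact.volume_add_volume_le_of_add_subset {K L : Set ℝ} {C : Set ℝ}
    (hK : IsCompact K) (hL : IsCompact L) (hKne : K.Nonempty) (hLne : L.Nonempty)
    (h : K + L ⊆ C) : volume K + volume L ≤ volume C := by
  obtain ⟨a, haK, ha⟩ := hK.exists_isGreatest hKne
  obtain ⟨b, hbL, hb⟩ := hL.exists_isLeast hLne
  have hL' : MeasurableSet (a +ᵥ L) := hL.measurableSet.const_vadd a
  have hinter : volume ((b +ᵥ K) ∩ (a +ᵥ L)) = 0 := by
    refine measure_mono_null (t := {a + b}) ?_ (by simp)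
    rintro _ ⟨⟨x, hx, rfl⟩, ⟨y, hy, hxy⟩⟩
    have h1 := ha hx
    have h2 := hb hy
    simp only [vadd_eq_add] at hxy
    simp only [vadd_eq_add, Set.mem_singleton_iff]
    linarith
  calc volume K + volume L = volume (b +ᵥ K) + volume (a +ᵥ L) := by
        rw [measure_vadd, measure_vadd]
    _ = volume ((b +ᵥ K) ∪ (a +ᵥ L)) := by
        rw [← measure_union_add_inter (b +ᵥ K) hL', hinter, add_zero]
    _ ≤ volume C := by
        refine measure_mono (Set.union_subset ?_ ?_)
        · rintro _ ⟨x, hx, rfl⟩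
          exact h ⟨x, hx, b, hbL, add_comm _ _⟩
        · rintro _ ⟨y, hy, rfl⟩
          exact h ⟨a, haK, y, hy, rfl⟩

/-- The one-dimensional Brunn–Minkowski inequality for measurable sets. -/
theorem MeasurableSet.volume_add_volume_le_of_add_subset {A B C : Set ℝ}
    (hA : MeasurableSet A) (hB : MeasurableSet B) (hAne : A.Nonempty) (hBne : B.Nonempty)
    (h : A + B ⊆ C) : volume A + volume B ≤ volume C := by
  obtain ⟨a, ha⟩ := hAne
  obtain ⟨b, hb⟩ := hBne
  rw [hA.measure_eq_iSup_isCompact volume, hB.measure_eq_iSup_isCompact volume]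
  simp only [iSup_and']
  refine ENNReal.biSup_add_biSup_le' ⟨∅, by simp⟩ ⟨∅, by simp⟩ fun K hK L hL => ?_
  calc volume K + volume L ≤ volume (insert a K) + volume (insert b L) :=
        add_le_add (measure_mono (Set.subset_insert _ _)) (measure_mono (Set.subset_insert _ _))
    _ ≤ volume C :=
        (hK.2.insert a).volume_add_volume_le_of_add_subset (hL.2.insert b)
          (Set.insert_nonempty _ _) (Set.insert_nonempty _ _)
          ((Set.add_subset_add (Set.insert_subset ha hK.1) (Set.insert_subset hb hL.1)).trans h)

/-- The one-dimensional Brunn–Minkowski inequality for weighted sums of measurable sets. -/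
theorem MeasurableSet.ofReal_mul_volume_add_le {A B C : Set ℝ}
    (hA : MeasurableSet A) (hB : MeasurableSet B) (hAne : A.Nonempty) (hBne : B.Nonempty)
    {p q : ℝ} (hp : 0 < p) (hq : 0 < q)
    (h : ∀ x ∈ A, ∀ y ∈ B, p * x + q * y ∈ C) :
    ENNReal.ofReal p * volume A + ENNReal.ofReal q * volume B ≤ volume C := by
  have hsmul (r : ℝ) (hr : 0 < r) (S : Set ℝ) :
      ENNReal.ofReal r * volume S = volume (r • S) := by
    simp [Measure.addHaar_smul, abs_of_pos hr]
  rw [hsmul p hp, hsmul q hq]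
  refine (hA.const_smul₀ p).volume_add_volume_le_of_add_subset (hB.const_smul₀ q)
    hAne.smul_set hBne.smul_set ?_
  rintro _ ⟨_, ⟨x, hx, rfl⟩, _, ⟨y, hy, rfl⟩, rfl⟩
  exact h x hx y hy

/-- The layer cake formula for `ℝ≥0∞`-valued functions bounded by `1`. -/
theorem lintegral_eq_lintegral_meas_ofReal_lt {α : Type*} [MeasurableSpace α] (μ : Measure α)
    {f : α → ℝ≥0∞} (hf : Measurable f) (hf1 : ∀ x, f x ≤ 1) :
    ∫⁻ x, f x ∂μ = ∫⁻ t in Set.Ioi (0 : ℝ), μ {x | ENNReal.ofReal t < f x} := by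
  have hfin (x : α) : f x ≠ ∞ := ne_top_of_le_ne_top ENNReal.one_ne_top (hf1 x)
  have key := lintegral_eq_lintegral_meas_lt (f := fun x => (f x).toReal) μ
    (.of_forall fun x => ENNReal.toReal_nonneg) hf.ennreal_toReal.aemeasurable
  simp only [ENNReal.ofReal_toReal (hfin _)] at key
  rw [key]
  refine setLIntegral_congr_fun measurableSet_Ioi fun t ht => ?_
  simp only [ENNReal.ofReal_lt_iff_lt_toReal (le_of_lt ht) (hfin _)]

theorem ENNReal.geom_mean_le_arith_mean2_weighted (a b : ℝ≥0∞) {p q : ℝ}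
    (hp : 0 < p) (hq : 0 < q) (hpq : p + q = 1) :
    a ^ p * b ^ q ≤ ENNReal.ofReal p * a + ENNReal.ofReal q * b := by
  induction a with
  | top => simp [ENNReal.mul_top, hp]
  | coe a =>
    induction b with
    | top => simp [ENNReal.mul_top, hq]
    | coe b =>
      lift p to NNReal using hp.le
      lift q to NNReal using hq.le
      have := NNReal.geom_mean_le_arith_mean2_weighted p q a b (by exact_mod_cast hpq)
      rw [← ENNReal.coe_rpow_of_nonneg _ hp.le, ← ENNReal.coe_rpow_of_nonneg _ hq.le,
        ENNReal.ofReal_coe_nnreal, ENNReal.ofReal_coe_nnreal]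
      exact_mod_cast this

/-- An additive form of the one-dimensional Prékopa–Leindler inequality, for functions with
supremum `1`. -/
theorem lintegral_add_le_of_rpow_mul_rpow_le {f g h : ℝ → ℝ≥0∞}
    (hf : Measurable f) (hg : Measurable g) (hh : Measurable h)
    (hf1 : ⨆ x, f x = 1) (hg1 : ⨆ x, g x = 1)
    {p q : ℝ} (hp : 0 < p) (hq : 0 < q) (hpq : p + q = 1)
    (hfgh : ∀ x y, f x ^ p * g y ^ q ≤ h (p * x + q * y)) :
    ENNReal.ofReal p * (∫⁻ x, f x) + ENNReal.ofReal q * (∫⁻ x, g x) ≤ ∫⁻ x, h x := by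
  have hf1' (x : ℝ) : f x ≤ 1 := hf1 ▸ le_iSup f x
  have hg1' (x : ℝ) : g x ≤ 1 := hg1 ▸ le_iSup g x
  refine le_trans ?_ (lintegral_mono fun x => min_le_left (h x) 1)
  rw [lintegral_eq_lintegral_meas_ofReal_lt _ hf hf1',
    lintegral_eq_lintegral_meas_ofReal_lt _ hg hg1',
    lintegral_eq_lintegral_meas_ofReal_lt _ (hh.min measurable_const) fun x => min_le_right _ _,
    ← lintegral_const_mul' _ _ ENNReal.ofReal_ne_top,
    ← lintegral_const_mul' _ _ ENNReal.ofReal_ne_top]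
  refine (le_lintegral_add _ _).trans (setLIntegral_mono' measurableSet_Ioi fun t ht => ?_)
  have ht0 : ENNReal.ofReal t ≠ 0 := by simpa using ht
  rcases lt_or_ge (ENNReal.ofReal t) 1 with ht1 | ht1
  · refine (measurableSet_lt measurable_const hf).ofReal_mul_volume_add_le
      (measurableSet_lt measurable_const hg) (by rw [← hf1] at ht1; exact lt_iSup_iff.1 ht1)
      (by rw [← hg1] at ht1; exact lt_iSup_iff.1 ht1) hp hq fun x hx y hy =>
        lt_min (lt_of_lt_of_le ?_ (hfgh x y)) ht1
    calc ENNReal.ofReal t = ENNReal.ofReal t ^ p * ENNReal.ofReal t ^ q := by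
          rw [← ENNReal.rpow_add _ _ ht0 ENNReal.ofReal_ne_top, hpq, ENNReal.rpow_one]
      _ < f x ^ p * g y ^ q :=
          ENNReal.mul_lt_mul (ENNReal.rpow_lt_rpow hx hp) (ENNReal.rpow_lt_rpow hy hq)
  · simp [((hf1' _).trans ht1).not_gt, ((hg1' _).trans ht1).not_gt]

/-- The one-dimensional Prékopa–Leindler inequality for bounded functions. -/
theorem lintegral_rpow_mul_le_of_bounded {f g h : ℝ → ℝ≥0∞}
    (hf : Measurable f) (hg : Measurable g) (hh : Measurable h)
    (hf1 : ⨆ x, f x ≠ ∞) (hg1 : ⨆ x, g x ≠ ∞)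
    {p q : ℝ} (hp : 0 < p) (hq : 0 < q) (hpq : p + q = 1)
    (hfgh : ∀ x y, f x ^ p * g y ^ q ≤ h (p * x + q * y)) :
    (∫⁻ x, f x) ^ p * (∫⁻ x, g x) ^ q ≤ ∫⁻ x, h x := by
  by_cases hf0 : ⨆ x, f x = 0
  · simp [ENNReal.iSup_eq_zero.1 hf0, hp]
  by_cases hg0 : ⨆ x, g x = 0
  · simp [ENNReal.iSup_eq_zero.1 hg0, hq]
  set a := ⨆ x, f x
  set b := ⨆ x, g x
  set c := a⁻¹ ^ p * b⁻¹ ^ q with hc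
  have hc0 : c ≠ 0 := mul_ne_zero (by simp [hp.not_gt, hf1]) (by simp [hq.not_gt, hg1])
  have hcfin : c ≠ ∞ := ENNReal.mul_ne_top
    (ENNReal.rpow_ne_top_of_nonneg hp.le (ENNReal.inv_ne_top.2 hf0))
    (ENNReal.rpow_ne_top_of_nonneg hq.le (ENNReal.inv_ne_top.2 hg0))
  have hmul (u v : ℝ≥0∞) : (u * a⁻¹) ^ p * (v * b⁻¹) ^ q = u ^ p * v ^ q * c := by
    rw [ENNReal.mul_rpow_of_nonneg _ _ hp.le, ENNReal.mul_rpow_of_nonneg _ _ hq.le, hc]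
    ring
  have key := lintegral_add_le_of_rpow_mul_rpow_le (hf.mul_const a⁻¹) (hg.mul_const b⁻¹)
    (hh.mul_const c) (by rw [← ENNReal.iSup_mul, ENNReal.mul_inv_cancel hf0 hf1])
    (by rw [← ENNReal.iSup_mul, ENNReal.mul_inv_cancel hg0 hg1]) hp hq hpq
    fun x y => by rw [hmul]; gcongr; exact hfgh x y
  have := (ENNReal.geom_mean_le_arith_mean2_weighted _ _ hp hq hpq).trans key
  rw [lintegral_mul_const _ hf, lintegral_mul_const _ hg, lintegral_mul_const _ hh, hmul] at this
  exact (ENNReal.mul_le_mul_iff_left hc0 hcfin).1 this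

theorem ENNReal.iSup_min_natCast (a : ℝ≥0∞) : ⨆ n : ℕ, min a n = a := by
  rw [← inf_iSup_eq, ENNReal.iSup_natCast, inf_top_eq]

theorem lintegral_eq_iSup_lintegral_min_natCast {α : Type*} [MeasurableSpace α] {μ : Measure α}
    {f : α → ℝ≥0∞} (hf : Measurable f) : ∫⁻ x, f x ∂μ = ⨆ n : ℕ, ∫⁻ x, min (f x) n ∂μ := by
  rw [← lintegral_iSup (fun n => hf.min measurable_const)
    fun m n hmn x => min_le_min_left _ (by exact_mod_cast hmn)]
  simp only [ENNReal.iSup_min_natCast]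

/-- The one-dimensional Prékopa–Leindler inequality. -/
theorem prekopa_leindler_real {f g h : ℝ → ℝ≥0∞}
    (hf : Measurable f) (hg : Measurable g) (hh : Measurable h)
    {p q : ℝ} (hp : 0 < p) (hq : 0 < q) (hpq : p + q = 1)
    (hfgh : ∀ x y, f x ^ p * g y ^ q ≤ h (p * x + q * y)) :
    (∫⁻ x, f x) ^ p * (∫⁻ x, g x) ^ q ≤ ∫⁻ x, h x := by
  have hpow (r : ℝ) (hr : 0 < r) (u : ℕ → ℝ≥0∞) : (⨆ n, u n) ^ r = ⨆ n, u n ^ r :=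
    (ENNReal.orderIsoRpow r hr).map_iSup u
  rw [lintegral_eq_iSup_lintegral_min_natCast hf, lintegral_eq_iSup_lintegral_min_natCast hg,
    hpow p hp, hpow q hq, ENNReal.iSup_mul]
  refine iSup_le fun m => ?_
  rw [ENNReal.mul_iSup]
  refine iSup_le fun n => lintegral_rpow_mul_le_of_bounded (hf.min measurable_const)
    (hg.min measurable_const) hh
    (ne_top_of_le_ne_top (ENNReal.natCast_ne_top m) (iSup_le fun x => min_le_right _ _))
    (ne_top_of_le_ne_top (ENNReal.natCast_ne_top n) (iSup_le fun x => min_le_right _ _))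
    hp hq hpq fun x y => le_trans ?_ (hfgh x y)
  gcongr <;> exact min_le_left _ _

theorem lintegral_pi_fin_succ {n : ℕ} {f : (Fin (n + 1) → ℝ) → ℝ≥0∞} (hf : Measurable f) :
    ∫⁻ x, f x = ∫⁻ s : ℝ, ∫⁻ y : Fin n → ℝ, f (Fin.cons s y) := by
  have e := (volume_preserving_piFinSuccAbove (fun _ : Fin (n + 1) => ℝ) 0).symm
  rw [← e.lintegral_comp hf, Measure.volume_eq_prod, lintegral_prod]
  · simp [MeasurableEquiv.piFinSuccAbove_symm_apply, Fin.insertNthEquiv]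
  · exact (hf.comp e.measurable).aemeasurable

/-- The Prékopa–Leindler inequality on `ℝⁿ`. -/
theorem prekopa_leindler {n : ℕ} {f g h : (Fin n → ℝ) → ℝ≥0∞}
    (hf : Measurable f) (hg : Measurable g) (hh : Measurable h)
    {p q : ℝ} (hp : 0 < p) (hq : 0 < q) (hpq : p + q = 1)
    (hfgh : ∀ x y, f x ^ p * g y ^ q ≤ h (p • x + q • y)) :
    (∫⁻ x, f x) ^ p * (∫⁻ x, g x) ^ q ≤ ∫⁻ x, h x := by
  induction n with
  | zero =>
    have hI (u : (Fin 0 → ℝ) → ℝ≥0∞) : ∫⁻ x, u x = u 0 := by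
      rw [volume_pi, Measure.pi_of_empty _ 0, lintegral_dirac]
    rw [hI, hI, hI]
    simpa using hfgh 0 0
  | succ n ih =>
    have hcons : Measurable fun z : ℝ × (Fin n → ℝ) => (Fin.cons z.1 z.2 : Fin (n + 1) → ℝ) :=
      measurable_pi_iff.2 fun i => by
        refine Fin.cases ?_ (fun j => ?_) i
        · simpa using measurable_fst
        · simpa using! (measurable_pi_apply j).comp measurable_snd
    have hmarg {u : (Fin (n + 1) → ℝ) → ℝ≥0∞} (hu : Measurable u) :
        Measurable fun s : ℝ => ∫⁻ y : Fin n → ℝ, u (Fin.cons s y) :=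
      (hu.comp hcons).lintegral_prod_right'
    have hslice {u : (Fin (n + 1) → ℝ) → ℝ≥0∞} (hu : Measurable u) (s : ℝ) :
        Measurable fun y : Fin n → ℝ => u (Fin.cons s y) :=
      (hu.comp hcons).comp measurable_prodMk_left
    rw [lintegral_pi_fin_succ hf, lintegral_pi_fin_succ hg, lintegral_pi_fin_succ hh]
    refine prekopa_leindler_real (hmarg hf) (hmarg hg) (hmarg hh) hp hq hpq fun s t =>
      ih (hslice hf s) (hslice hg t) (hslice hh _) fun x y => ?_
    convert hfgh (Fin.cons s x) (Fin.cons t y) using 2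
    ext i
    refine Fin.cases ?_ (fun j => ?_) i <;> simp

theorem measurableSet_ranking {m : ℕ} (π : Equiv.Perm (Fin m)) :
    MeasurableSet {x : Fin m → ℝ | ∀ k l : Fin m, k < l → x (π l) < x (π k)} := by
  simp only [Set.ofPred_forall]
  exact .iInter fun k => .iInter fun l => .iInter fun _ =>
    measurableSet_lt (measurable_pi_apply _) (measurable_pi_apply _)

theorem rumProb_nonneg {m : ℕ} {f : Fin m → ℝ → ℝ} (hf : ∀ j x, 0 ≤ f j x) (θ : Fin m → ℝ)
    (π : Equiv.Perm (Fin m)) : 0 ≤ rumProb f θ π :=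
  integral_nonneg fun _ => Finset.prod_nonneg fun _ _ => hf _ _

theorem ofReal_rumProb {m : ℕ} {f : Fin m → ℝ → ℝ} (hf : ∀ j x, 0 ≤ f j x)
    (hint : ∀ j, Integrable (f j)) (θ : Fin m → ℝ) (π : Equiv.Perm (Fin m)) :
    ENNReal.ofReal (rumProb f θ π) =
      ∫⁻ x, {x : Fin m → ℝ | ∀ k l : Fin m, k < l → x (π l) < x (π k)}.indicator
        (fun x => ENNReal.ofReal (∏ j, f j (x j - θ j))) x := by
  have hprod : Integrable fun x : Fin m → ℝ => ∏ j, f j (x j - θ j) :=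
    Integrable.fintype_prod (f := fun j t => f j (t - θ j)) fun j => (hint j).comp_sub_right (θ j)
  rw [rumProb, lintegral_indicator (measurableSet_ranking π),
    ofReal_integral_eq_lintegral_ofReal hprod.integrableOn
      (.of_forall fun _ => Finset.prod_nonneg fun _ _ => hf _ _)]

/-- Ranking probabilities in a location family with log-concave densities are log-concave in the
location parameters. -/
theorem rumProb_rpow_mul_rpow_le {m : ℕ} {f : Fin m → ℝ → ℝ}
    (hmeas : ∀ j, Measurable (f j)) (hnonneg : ∀ j x, 0 ≤ f j x) (hint : ∀ j, Integrable (f j))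
    {p q : ℝ} (hp : 0 < p) (hq : 0 < q) (hpq : p + q = 1)
    (hf : ∀ j x y, f j x ^ p * f j y ^ q ≤ f j (p * x + q * y))
    (π : Equiv.Perm (Fin m)) (θ θ' : Fin m → ℝ) :
    rumProb f θ π ^ p * rumProb f θ' π ^ q ≤ rumProb f (p • θ + q • θ') π := by
  have hmeas' (θ : Fin m → ℝ) :
      Measurable ({x : Fin m → ℝ | ∀ k l : Fin m, k < l → x (π l) < x (π k)}.indicator
        fun x => ENNReal.ofReal (∏ j, f j (x j - θ j))) := by
    refine Measurable.indicator ?_ (measurableSet_ranking π)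
    fun_prop
  have hprod (θ x : Fin m → ℝ) : 0 ≤ ∏ j, f j (x j - θ j) :=
    Finset.prod_nonneg fun _ _ => hnonneg _ _
  have hP := rumProb_nonneg hnonneg
  rw [← ENNReal.ofReal_le_ofReal_iff (hP _ π),
    ENNReal.ofReal_mul (Real.rpow_nonneg (hP _ π) _),
    ← ENNReal.ofReal_rpow_of_nonneg (hP _ π) hp.le,
    ← ENNReal.ofReal_rpow_of_nonneg (hP _ π) hq.le, ofReal_rumProb hnonneg hint,
    ofReal_rumProb hnonneg hint, ofReal_rumProb hnonneg hint]
  refine prekopa_leindler (hmeas' θ) (hmeas' θ') (hmeas' _) hp hq hpq fun x y => ?_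
  by_cases hx : x ∈ {x : Fin m → ℝ | ∀ k l : Fin m, k < l → x (π l) < x (π k)}
  swap
  · simp [Set.indicator_of_notMem hx, hp]
  by_cases hy : y ∈ {x : Fin m → ℝ | ∀ k l : Fin m, k < l → x (π l) < x (π k)}
  swap
  · simp [Set.indicator_of_notMem hy, hq]
  have hxy : p • x + q • y ∈ {x : Fin m → ℝ | ∀ k l : Fin m, k < l → x (π l) < x (π k)} :=
    fun k l hkl => add_lt_add (mul_lt_mul_of_pos_left (hx k l hkl) hp)
      (mul_lt_mul_of_pos_left (hy k l hkl) hq)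
  rw [Set.indicator_of_mem hx, Set.indicator_of_mem hy, Set.indicator_of_mem hxy,
    ENNReal.ofReal_rpow_of_nonneg (hprod _ _) hp.le,
    ENNReal.ofReal_rpow_of_nonneg (hprod _ _) hq.le,
    ← ENNReal.ofReal_mul (Real.rpow_nonneg (hprod _ _) _),
    ← Real.finsetProd_rpow _ _ fun _ _ => hnonneg _ _,
    ← Real.finsetProd_rpow _ _ fun _ _ => hnonneg _ _, ← Finset.prod_mul_distrib]
  refine ENNReal.ofReal_le_ofReal (Finset.prod_le_prod (fun j _ =>
    mul_nonneg (Real.rpow_nonneg (hnonneg _ _) _) (Real.rpow_nonneg (hnonneg _ _) _))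
    fun j _ => (hf j _ _).trans_eq ?_)
  congr 1
  simp only [Pi.add_apply, Pi.smul_apply, smul_eq_mul]
  ring

theorem stmt0 (m n : ℕ) (f : Fin m → ℝ → ℝ)
    (hmeas : ∀ j, Measurable (f j))
    (hnonneg : ∀ j x, 0 ≤ f j x)
    (hint : ∀ j, ∫ x, f j x = 1)
    (hlogconcave : ∀ j (x y lam : ℝ), 0 ≤ lam → lam ≤ 1 →
      f j x ^ lam * f j y ^ (1 - lam) ≤ f j (lam * x + (1 - lam) * y)) :
    -- θ ↦ Pr(π|θ) is log-concave on ℝ^m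
    (∀ (π : Equiv.Perm (Fin m)) (θ θ' : Fin m → ℝ) (lam : ℝ),
      0 ≤ lam → lam ≤ 1 →
      rumProb f θ π ^ lam * rumProb f θ' π ^ (1 - lam) ≤
        rumProb f (lam • θ + (1 - lam) • θ') π) ∧
    -- consequently the log-likelihood is concave wherever it is finite
    (∀ (D : Fin n → Equiv.Perm (Fin m)) (θ θ' : Fin m → ℝ) (lam : ℝ),
      0 ≤ lam → lam ≤ 1 →
      (∀ i, 0 < rumProb f θ (D i)) → (∀ i, 0 < rumProb f θ' (D i)) →
      lam * (∑ i, Real.log (rumProb f θ (D i))) +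
          (1 - lam) * (∑ i, Real.log (rumProb f θ' (D i))) ≤
        ∑ i, Real.log (rumProb f (lam • θ + (1 - lam) • θ') (D i))) := by
  have hint' (j : Fin m) : Integrable (f j) :=
    .of_integral_ne_zero (by simp [hint j])
  have key (π : Equiv.Perm (Fin m)) (θ θ' : Fin m → ℝ) (lam : ℝ) (h0 : 0 ≤ lam) (h1 : lam ≤ 1) :
      rumProb f θ π ^ lam * rumProb f θ' π ^ (1 - lam) ≤
        rumProb f (lam • θ + (1 - lam) • θ') π := by
    rcases h0.eq_or_lt with rfl | h0
    · simp
    rcases h1.eq_or_lt with rfl | h1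
    · simp
    exact rumProb_rpow_mul_rpow_le hmeas hnonneg hint' h0 (sub_pos.2 h1) (by ring)
      (fun j x y => hlogconcave j x y lam h0.le h1.le) π θ θ'
  refine ⟨key, fun D θ θ' lam h0 h1 hθ hθ' => ?_⟩
  rw [Finset.mul_sum, Finset.mul_sum, ← Finset.sum_add_distrib]
  refine Finset.sum_le_sum fun i _ => ?_
  have hθi := Real.rpow_pos_of_pos (hθ i) lam
  have hθi' := Real.rpow_pos_of_pos (hθ' i) (1 - lam)
  rw [← Real.log_rpow (hθ i), ← Real.log_rpow (hθ' i), ← Real.log_mul hθi.ne' hθi'.ne']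
  exact Real.log_le_log (mul_pos hθi hθi') (key (D i) θ θ' lam h0 h1)
end

section
/- Let f : ℝ^m → [0,∞) be an integrable log-concave function (the joint density of a random vector ζ ∈ ℝ^m), and let g_1,…,g_R : ℝ^m × ℝ^m → ℝ be concave functions of the pair (θ, ζ) ∈ ℝ^{2m}. Then the function L(θ) = ∫_{{ζ ∈ ℝ^m : g_r(θ,ζ) ≥ 0 for all r = 1,…,R}} f(ζ) dζ is log-concave in θ on ℝ^m: for all θ, θ′ ∈ ℝ^m and λ ∈ [0,1], L(λθ+(1−λ)θ′) ≥ L(θ)^λ · L(θ′)^{1−λ}. -/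
open MeasureTheory

open scoped Pointwise in
/-- The volume of the image of a subset of `ℝ` under an increasing affine map. -/
lemma volume_image_affine {a : ℝ} (ha : 0 < a) (c : ℝ) (K : Set ℝ) :
    volume ((fun x => a * x + c) '' K) = ENNReal.ofReal a * volume K := by
  have : (fun x => a * x + c) '' K = (fun h => -c + h) ⁻¹' (a • K) := by
    ext y
    simp only [Set.mem_image, Set.mem_preimage, Set.mem_smul_set, smul_eq_mul]
    refine exists_congr fun x => and_congr_right fun _ => ?_
    constructor <;> intro h <;> linarith
  rw [this, measure_preimage_add, Measure.addHaar_smul]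
  simp [abs_of_pos ha]

/-- The one-dimensional Brunn–Minkowski inequality for compact sets. -/
lemma IsCompact.volume_add_volume_le {a b : ℝ} (ha : 0 < a) (hb : 0 < b) {K L C : Set ℝ}
    (hK : IsCompact K) (hL : IsCompact L) (hKne : K.Nonempty) (hLne : L.Nonempty)
    (h : ∀ x ∈ K, ∀ y ∈ L, a * x + b * y ∈ C) :
    ENNReal.ofReal a * volume K + ENNReal.ofReal b * volume L ≤ volume C := by
  obtain ⟨M, hMK, hM⟩ := hK.exists_isGreatest hKne
  obtain ⟨m, hmL, hm⟩ := hL.exists_isLeast hLne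
  rw [← volume_image_affine ha (b * m) K, ← volume_image_affine hb (a * M) L]
  rw [← measure_union₀]
  · refine measure_mono ?_
    rintro _ (⟨x, hx, rfl⟩ | ⟨y, hy, rfl⟩)
    · exact h x hx m hmL
    · simpa only [add_comm] using h M hMK y hy
  · exact (hL.image (by fun_prop)).measurableSet.nullMeasurableSet
  · refine measure_mono_null (t := {a * M + b * m}) ?_ (by simp)
    rintro _ ⟨⟨x, hx, rfl⟩, ⟨y, hy, hxy⟩⟩
    have h1 := mul_le_mul_of_nonneg_left (hM hx) ha.le
    have h2 := mul_le_mul_of_nonneg_left (hm hy) hb.le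
    simp only [Set.mem_singleton_iff] at hxy ⊢
    linarith

/-- The volume of a measurable set is the supremum over its nonempty compact subsets. -/
lemma MeasurableSet.volume_eq_iSup_isCompact_nonempty {A : Set ℝ} (hA : MeasurableSet A) :
    volume A = ⨆ K : {K : Set ℝ // K ⊆ A ∧ IsCompact K ∧ K.Nonempty}, volume K.1 := by
  refine le_antisymm (le_of_forall_lt fun r hr => ?_) (iSup_le fun K => measure_mono K.2.1)
  obtain ⟨K, hKA, hK, hrK⟩ := hA.exists_lt_isCompact hr
  exact hrK.trans_le (le_iSup (fun K : {K : Set ℝ // K ⊆ A ∧ IsCompact K ∧ K.Nonempty} =>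
    volume K.1) ⟨K, hKA, hK, nonempty_of_measure_ne_zero (ne_bot_of_gt hrK)⟩)

/-- The one-dimensional Brunn–Minkowski inequality. -/
lemma MeasurableSet.volume_add_volume_le {a b : ℝ} (ha : 0 < a) (hb : 0 < b) {A B C : Set ℝ}
    (hA : MeasurableSet A) (hB : MeasurableSet B) (hAne : A.Nonempty) (hBne : B.Nonempty)
    (h : ∀ x ∈ A, ∀ y ∈ B, a * x + b * y ∈ C) :
    ENNReal.ofReal a * volume A + ENNReal.ofReal b * volume B ≤ volume C := by
  have : Nonempty {K : Set ℝ // K ⊆ A ∧ IsCompact K ∧ K.Nonempty} := by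
    obtain ⟨x, hx⟩ := hAne
    exact ⟨{x}, by simpa using hx, isCompact_singleton, Set.singleton_nonempty x⟩
  have : Nonempty {K : Set ℝ // K ⊆ B ∧ IsCompact K ∧ K.Nonempty} := by
    obtain ⟨x, hx⟩ := hBne
    exact ⟨{x}, by simpa using hx, isCompact_singleton, Set.singleton_nonempty x⟩
  rw [hA.volume_eq_iSup_isCompact_nonempty, hB.volume_eq_iSup_isCompact_nonempty,
    ENNReal.mul_iSup, ENNReal.mul_iSup]
  refine ENNReal.iSup_add_iSup_le fun K L => ?_
  exact K.2.2.1.volume_add_volume_le ha hb L.2.2.1 K.2.2.2 L.2.2.2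
    fun x hx y hy => h x (K.2.1 hx) y (L.2.1 hy)

/-- Integrated one-dimensional Brunn–Minkowski inequality for functions with supremum one. -/
lemma lintegral_add_lintegral_le_of_min_le {a b : ℝ} (ha : 0 < a) (hb : 0 < b) {f g h : ℝ → ℝ}
    (hf : Measurable f) (hg : Measurable g) (hh : Measurable h)
    (hf0 : 0 ≤ f) (hg0 : 0 ≤ g) (hh0 : 0 ≤ h) (hf1 : ∀ x, f x ≤ 1) (hg1 : ∀ x, g x ≤ 1)
    (hfs : ∀ t < 1, ∃ x, t < f x) (hgs : ∀ t < 1, ∃ x, t < g x)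
    (hfgh : ∀ x y, min (f x) (g y) ≤ h (a * x + b * y)) :
    ENNReal.ofReal a * (∫⁻ x, ENNReal.ofReal (f x)) +
      ENNReal.ofReal b * (∫⁻ x, ENNReal.ofReal (g x)) ≤ ∫⁻ x, ENNReal.ofReal (h x) := by
  have meas : ∀ u : ℝ → ℝ, Measurable fun t : ℝ => volume {x | t < u x} := fun u =>
    Antitone.measurable fun s t hst => measure_mono fun x hx => lt_of_le_of_lt hst hx
  rw [lintegral_eq_lintegral_meas_lt _ (.of_forall hf0) hf.aemeasurable,
    lintegral_eq_lintegral_meas_lt _ (.of_forall hg0) hg.aemeasurable,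
    lintegral_eq_lintegral_meas_lt _ (.of_forall hh0) hh.aemeasurable,
    ← lintegral_const_mul _ (meas f), ← lintegral_const_mul _ (meas g),
    ← lintegral_add_left ((meas f).const_mul _)]
  refine lintegral_mono fun t => ?_
  rcases lt_or_ge t 1 with ht | ht
  · exact (measurableSet_lt measurable_const hf).volume_add_volume_le ha hb
      (measurableSet_lt measurable_const hg) (hfs t ht) (hgs t ht)
      fun x hx y hy => (lt_min hx hy).trans_le (hfgh x y)
  · have hfe : {x | t < f x} = ∅ := by
      ext x; simpa using (hf1 x).trans ht
    have hge : {x | t < g x} = ∅ := by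
      ext x; simpa using (hg1 x).trans ht
    simp [hfe, hge]

/-- Weighted arithmetic-geometric mean inequality in `ENNReal`. -/
lemma ENNReal.rpow_mul_rpow_le_add {lam : ℝ} (h0 : 0 < lam) (h1 : lam < 1) (p q : ENNReal) :
    p ^ lam * q ^ (1 - lam) ≤ ENNReal.ofReal lam * p + ENNReal.ofReal (1 - lam) * q := by
  have h1' : 0 < 1 - lam := sub_pos.2 h1
  rcases eq_or_ne p ⊤ with rfl | hp
  · simp [ENNReal.mul_top, h0]
  rcases eq_or_ne q ⊤ with rfl | hq
  · simp [ENNReal.mul_top, h1]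
  lift p to NNReal using hp
  lift q to NNReal using hq
  have := NNReal.geom_mean_le_arith_mean2_weighted lam.toNNReal (1 - lam).toNNReal p q
    (by rw [← Real.toNNReal_add h0.le h1'.le]; simp)
  rw [Real.coe_toNNReal _ h0.le, Real.coe_toNNReal _ h1'.le] at this
  rw [← ENNReal.coe_rpow_of_nonneg _ h0.le, ← ENNReal.coe_rpow_of_nonneg _ h1'.le]
  simp only [ENNReal.ofReal]
  exact_mod_cast this

/-- The Prékopa–Leindler property of a measure on a real vector space. -/
def PrekopaLeindler {E : Type*} [AddCommGroup E] [Module ℝ E] [MeasurableSpace E]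
    (μ : Measure E) : Prop :=
  ∀ lam : ℝ, 0 < lam → lam < 1 → ∀ f g h : E → ENNReal,
    Measurable f → Measurable g → Measurable h →
    (∀ x y, f x ^ lam * g y ^ (1 - lam) ≤ h (lam • x + (1 - lam) • y)) →
    (∫⁻ x, f x ∂μ) ^ lam * (∫⁻ x, g x ∂μ) ^ (1 - lam) ≤ ∫⁻ x, h x ∂μ

/-- A function with positive finite supremum comes arbitrarily close to it. -/
lemma ENNReal.exists_lt_toReal_div_iSup {f : ℝ → ENNReal} (h0 : ⨆ x, f x ≠ 0)
    (htop : ⨆ x, f x ≠ ⊤) {t : ℝ} (ht : t < 1) : ∃ x, t < (f x / ⨆ x, f x).toReal := by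
  by_contra! H
  have ht0 : 0 ≤ t := ENNReal.toReal_nonneg.trans (H 0)
  have hne : ∀ x, f x / ⨆ x, f x ≠ ⊤ := fun x =>
    (ENNReal.div_lt_top ((le_iSup f x).trans_lt htop.lt_top).ne h0).ne
  have : ⨆ x, f x ≤ ENNReal.ofReal t * ⨆ x, f x := iSup_le fun x =>
    (ENNReal.div_le_iff h0 htop).1 ((ENNReal.le_ofReal_iff_toReal_le (hne x) ht0).2 (H x))
  have h2 : ENNReal.ofReal t * (⨆ x, f x) < 1 * ⨆ x, f x :=
    ENNReal.mul_lt_mul_left h0 htop (by simpa using ht)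
  rw [one_mul] at h2
  exact absurd this h2.not_ge

/-- The one-dimensional Prékopa–Leindler inequality for bounded functions. -/
lemma prekopaLeindler_real_of_bounded {lam : ℝ} (h0 : 0 < lam) (h1 : lam < 1)
    {f g h : ℝ → ENNReal} (hf : Measurable f) (hg : Measurable g) (hh : Measurable h)
    (hfgh : ∀ x y, f x ^ lam * g y ^ (1 - lam) ≤ h (lam • x + (1 - lam) • y))
    (hft : ⨆ x, f x ≠ ⊤) (hgt : ⨆ x, g x ≠ ⊤) :
    (∫⁻ x, f x) ^ lam * (∫⁻ x, g x) ^ (1 - lam) ≤ ∫⁻ x, h x := by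
  have h1' : 0 < 1 - lam := sub_pos.2 h1
  rcases eq_or_ne (⨆ x, f x) 0 with hf0 | hf0
  · have : f = 0 := funext fun x => by simpa using (le_iSup f x).trans hf0.le
    simp [this, h0]
  rcases eq_or_ne (⨆ x, g x) 0 with hg0 | hg0
  · have : g = 0 := funext fun x => by simpa using (le_iSup g x).trans hg0.le
    simp [this, h1]
  set M := ⨆ x, f x with hM
  set N := ⨆ x, g x with hN
  set C := M ^ lam * N ^ (1 - lam) with hC
  have hMl0 : M ^ lam ≠ 0 := by simp [ENNReal.rpow_eq_zero_iff, hf0, hft]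
  have hNl0 : N ^ (1 - lam) ≠ 0 := by simp [ENNReal.rpow_eq_zero_iff, hg0, hgt]
  have hMlt : M ^ lam ≠ ⊤ := ENNReal.rpow_ne_top_of_nonneg h0.le hft
  have hNlt : N ^ (1 - lam) ≠ ⊤ := ENNReal.rpow_ne_top_of_nonneg h1'.le hgt
  have hC0 : C ≠ 0 := mul_ne_zero hMl0 hNl0
  have hCt : C ≠ ⊤ := ENNReal.mul_ne_top hMlt hNlt
  have hfM : ∀ x, f x / M ≤ 1 := fun x => ENNReal.div_le_of_le_mul (by simpa using le_iSup f x)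
  have hgN : ∀ x, g x / N ≤ 1 := fun x => ENNReal.div_le_of_le_mul (by simpa using le_iSup g x)
  have hfMt : ∀ x, f x / M ≠ ⊤ := fun x => ((hfM x).trans_lt ENNReal.one_lt_top).ne
  have hgNt : ∀ x, g x / N ≠ ⊤ := fun x => ((hgN x).trans_lt ENNReal.one_lt_top).ne
  have hht : ∀ x, min (h x / C) 1 ≠ ⊤ := fun x =>
    ((min_le_right _ _).trans_lt ENNReal.one_lt_top).ne
  have key := lintegral_add_lintegral_le_of_min_le h0 h1'
    (f := fun x => (f x / M).toReal) (g := fun x => (g x / N).toReal)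
    (h := fun x => (min (h x / C) 1).toReal)
    (hf.div_const _).ennreal_toReal (hg.div_const _).ennreal_toReal
    ((hh.div_const _).min measurable_const).ennreal_toReal
    (fun _ => ENNReal.toReal_nonneg) (fun _ => ENNReal.toReal_nonneg)
    (fun _ => ENNReal.toReal_nonneg)
    (fun x => ENNReal.toReal_le_of_le_ofReal zero_le_one (by simpa using hfM x))
    (fun x => ENNReal.toReal_le_of_le_ofReal zero_le_one (by simpa using hgN x))
    (fun t ht => ENNReal.exists_lt_toReal_div_iSup hf0 hft ht)
    (fun t ht => ENNReal.exists_lt_toReal_div_iSup hg0 hgt ht)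
    (fun x y => by
      rw [← ENNReal.toReal_min (hfMt x) (hgNt y)]
      refine ENNReal.toReal_mono (hht _) (le_min ?_ ((min_le_left _ _).trans (hfM x)))
      set r := min (f x / M) (g y / N)
      have hr : r = r ^ lam * r ^ (1 - lam) := by
        rw [← ENNReal.rpow_add_of_nonneg _ _ h0.le h1'.le]; simp
      calc r = r ^ lam * r ^ (1 - lam) := hr
        _ ≤ (f x / M) ^ lam * (g y / N) ^ (1 - lam) := by
          gcongr
          · exact min_le_left _ _
          · exact min_le_right _ _
        _ = (f x ^ lam * g y ^ (1 - lam)) / C := by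
          rw [ENNReal.div_rpow_of_nonneg _ _ h0.le, ENNReal.div_rpow_of_nonneg _ _ h1'.le,
            ENNReal.mul_div_mul_comm (.inl hMl0) (.inl hMlt)]
        _ ≤ _ := by gcongr; exact hfgh x y)
  simp only [ENNReal.ofReal_toReal (hfMt _), ENNReal.ofReal_toReal (hgNt _),
    ENNReal.ofReal_toReal (hht _)] at key
  have hle : ∫⁻ x, min (h x / C) 1 ≤ (∫⁻ x, h x) / C := by
    simp only [div_eq_mul_inv]
    rw [← lintegral_mul_const _ hh]
    exact lintegral_mono fun x => min_le_left _ _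
  have h2 := (ENNReal.rpow_mul_rpow_le_add h0 h1 _ _).trans (key.trans hle)
  simp only [div_eq_mul_inv] at h2
  rw [lintegral_mul_const _ hf, lintegral_mul_const _ hg] at h2
  simp only [← div_eq_mul_inv] at h2
  rw [ENNReal.div_rpow_of_nonneg _ _ h0.le, ENNReal.div_rpow_of_nonneg _ _ h1'.le,
    ← ENNReal.mul_div_mul_comm (.inl hMl0) (.inl hMlt)] at h2
  simpa only [ENNReal.div_mul_cancel hC0 hCt] using (ENNReal.div_le_iff hC0 hCt).1 h2

lemma ENNReal.tendsto_lintegral_min_natCast {α : Type*} [MeasurableSpace α] {μ : Measure α}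
    {f : α → ENNReal} (hf : Measurable f) :
    Filter.Tendsto (fun n : ℕ => ∫⁻ x, min (f x) n ∂μ) Filter.atTop (nhds (∫⁻ x, f x ∂μ)) := by
  refine lintegral_tendsto_of_tendsto_of_monotone
    (fun n => (hf.min measurable_const).aemeasurable)
    (.of_forall fun x m n hmn => min_le_min le_rfl (by exact_mod_cast hmn))
    (.of_forall fun x => ?_)
  simpa using (tendsto_const_nhds (x := f x)).min ENNReal.tendsto_nat_nhds_top

/-- The one-dimensional Prékopa–Leindler inequality. -/
lemma prekopaLeindler_real : PrekopaLeindler (volume : Measure ℝ) := by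
  intro lam h0 h1 f g h hf hg hh hfgh
  have h1' : 0 < 1 - lam := sub_pos.2 h1
  rcases eq_or_ne ((∫⁻ x, f x) ^ lam) 0 with hf0 | hf0
  · simp [hf0]
  rcases eq_or_ne ((∫⁻ x, g x) ^ (1 - lam)) 0 with hg0 | hg0
  · simp [hg0]
  have hlim := ENNReal.Tendsto.mul
    ((ENNReal.continuous_rpow_const (y := lam)).continuousAt.tendsto.comp
      (ENNReal.tendsto_lintegral_min_natCast (μ := volume) hf)) (.inl hf0)
    ((ENNReal.continuous_rpow_const (y := 1 - lam)).continuousAt.tendsto.comp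
      (ENNReal.tendsto_lintegral_min_natCast (μ := volume) hg)) (.inl hg0)
  refine le_of_tendsto' hlim fun n => ?_
  refine prekopaLeindler_real_of_bounded h0 h1 (hf.min measurable_const)
    (hg.min measurable_const) hh (fun x y => le_trans ?_ (hfgh x y)) ?_ ?_
  · gcongr <;> exact min_le_left _ _
  all_goals
    exact ((iSup_le fun x => min_le_right _ _).trans_lt (ENNReal.natCast_lt_top n)).ne

/-- The Prékopa–Leindler property passes to product measures. -/
lemma PrekopaLeindler.prod {E F : Type*} [AddCommGroup E] [Module ℝ E] [MeasurableSpace E]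
    [AddCommGroup F] [Module ℝ F] [MeasurableSpace F] {μ : Measure E} {ν : Measure F}
    [SFinite ν] (hμ : PrekopaLeindler μ) (hν : PrekopaLeindler ν) :
    PrekopaLeindler (μ.prod ν) := by
  intro lam h0 h1 f g h hf hg hh hfgh
  rw [lintegral_prod _ hf.aemeasurable, lintegral_prod _ hg.aemeasurable,
    lintegral_prod _ hh.aemeasurable]
  refine hμ lam h0 h1 _ _ _ hf.lintegral_prod_right' hg.lintegral_prod_right'
    hh.lintegral_prod_right' fun x x' => ?_
  exact hν lam h0 h1 _ _ _ (hf.comp measurable_prodMk_left) (hg.comp measurable_prodMk_left)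
    (hh.comp measurable_prodMk_left) fun y y' => hfgh (x, y) (x', y')

/-- The Prékopa–Leindler inequality on `ℝ^m`. -/
lemma prekopaLeindler_pi (m : ℕ) : PrekopaLeindler (volume : Measure (Fin m → ℝ)) := by
  induction m with
  | zero =>
    intro lam h0 h1 f g h hf hg hh hfgh
    have hv : (volume : Measure (Fin 0 → ℝ)) Set.univ = 1 := by
      simp [volume_pi]
    simp only [lintegral_unique, hv, mul_one]
    convert hfgh default default
  | succ m ih =>
    intro lam h0 h1 f g h hf hg hh hfgh
    have e := (volume_preserving_piFinSuccAbove (fun _ : Fin (m + 1) => ℝ) 0).symm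
    rw [e.lintegral_map_equiv f, e.lintegral_map_equiv g, e.lintegral_map_equiv h]
    refine prekopaLeindler_real.prod ih lam h0 h1 _ _ _ (hf.comp e.measurable)
      (hg.comp e.measurable) (hh.comp e.measurable) fun x y => ?_
    convert hfgh _ _ using 2
    ext i
    refine Fin.cases ?_ (fun j => ?_) i <;> simp [MeasurableEquiv.piFinSuccAbove_symm_apply]

lemma AEMeasurable.exists_measurable_le {α : Type*} [MeasurableSpace α] {μ : Measure α}
    {f : α → ENNReal} (hf : AEMeasurable f μ) :
    ∃ f', Measurable f' ∧ f' ≤ f ∧ f' =ᵐ[μ] f := by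
  obtain ⟨t, ht, htm, ht0⟩ := exists_measurable_superset_of_null (ae_iff.1 hf.ae_eq_mk)
  have hmem : ∀ x ∉ t, f x = hf.mk f x := fun x hx => by
    by_contra hne
    exact hx (ht hne)
  refine ⟨tᶜ.indicator (hf.mk f), hf.measurable_mk.indicator htm.compl, fun x => ?_, ?_⟩
  · by_cases hx : x ∈ t <;> simp [hx, hmem]
  · filter_upwards [compl_mem_ae_iff.2 ht0] with x hx
    simp [hx, hmem x hx]

lemma AEMeasurable.exists_measurable_ge {α : Type*} [MeasurableSpace α] {μ : Measure α}
    {f : α → ENNReal} (hf : AEMeasurable f μ) :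
    ∃ f', Measurable f' ∧ f ≤ f' ∧ f' =ᵐ[μ] f := by
  classical
  obtain ⟨t, ht, htm, ht0⟩ := exists_measurable_superset_of_null (ae_iff.1 hf.ae_eq_mk)
  have hmem : ∀ x ∉ t, f x = hf.mk f x := fun x hx => by
    by_contra hne
    exact hx (ht hne)
  refine ⟨t.piecewise (fun _ => ⊤) (hf.mk f), measurable_const.piecewise htm hf.measurable_mk,
    fun x => ?_, ?_⟩
  · by_cases hx : x ∈ t <;> simp [hx, hmem]
  · filter_upwards [compl_mem_ae_iff.2 ht0] with x hx
    have hx' : x ∉ t := hx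
    simp [hx', hmem x hx']

/-- The Prékopa–Leindler property extends to almost everywhere measurable functions. -/
lemma PrekopaLeindler.lintegral_le {E : Type*} [AddCommGroup E] [Module ℝ E] [MeasurableSpace E]
    {μ : Measure E} (hμ : PrekopaLeindler μ) {lam : ℝ} (h0 : 0 < lam) (h1 : lam < 1)
    {f g h : E → ENNReal} (hf : AEMeasurable f μ) (hg : AEMeasurable g μ) (hh : AEMeasurable h μ)
    (hfgh : ∀ x y, f x ^ lam * g y ^ (1 - lam) ≤ h (lam • x + (1 - lam) • y)) :
    (∫⁻ x, f x ∂μ) ^ lam * (∫⁻ x, g x ∂μ) ^ (1 - lam) ≤ ∫⁻ x, h x ∂μ := by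
  have h1' : 0 < 1 - lam := sub_pos.2 h1
  obtain ⟨f', hf', hff, hfe⟩ := hf.exists_measurable_le
  obtain ⟨g', hg', hgg, hge⟩ := hg.exists_measurable_le
  obtain ⟨h', hh', hhh, hhe⟩ := hh.exists_measurable_ge
  rw [← lintegral_congr_ae hfe, ← lintegral_congr_ae hge, ← lintegral_congr_ae hhe]
  refine hμ lam h0 h1 f' g' h' hf' hg' hh' fun x y => ?_
  refine le_trans ?_ ((hfgh x y).trans (hhh _))
  gcongr
  · exact hff x
  · exact hgg y

/-- Prékopa's theorem on log-concavity of probabilities of concave constraint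
systems: if `f` is an integrable log-concave joint density on `ℝ^m` and
`g 1, …, g R` are concave functions of the pair `(θ, ζ) ∈ ℝ^{2m}`, then
`L(θ) = ∫_{ {ζ : ∀ r, g r θ ζ ≥ 0} } f ζ dζ` is log-concave in `θ`. -/
theorem stmt2 (m R : ℕ) (f : (Fin m → ℝ) → ℝ)
    (hf_nonneg : ∀ ζ, 0 ≤ f ζ)
    (hf_int : Integrable f)
    (hf_logconcave : ∀ (x y : Fin m → ℝ) (lam : ℝ), 0 ≤ lam → lam ≤ 1 →
      f x ^ lam * f y ^ (1 - lam) ≤ f (lam • x + (1 - lam) • y))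
    (g : Fin R → (Fin m → ℝ) → (Fin m → ℝ) → ℝ)
    (hg : ∀ r, ConcaveOn ℝ Set.univ
      (fun p : (Fin m → ℝ) × (Fin m → ℝ) => g r p.1 p.2))
    (θ θ' : Fin m → ℝ) (lam : ℝ) (h0 : 0 ≤ lam) (h1 : lam ≤ 1) :
    (∫ ζ in {ζ : Fin m → ℝ | ∀ r, 0 ≤ g r θ ζ}, f ζ) ^ lam *
        (∫ ζ in {ζ : Fin m → ℝ | ∀ r, 0 ≤ g r θ' ζ}, f ζ) ^ (1 - lam) ≤
      ∫ ζ in {ζ : Fin m → ℝ | ∀ r, 0 ≤ g r (lam • θ + (1 - lam) • θ') ζ}, f ζ := by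
  rcases h0.eq_or_lt with rfl | h0
  · simp
  rcases h1.eq_or_lt with rfl | h1
  · simp
  have h1' : 0 < 1 - lam := sub_pos.2 h1
  set S : (Fin m → ℝ) → Set (Fin m → ℝ) := fun η => {ζ | ∀ r, 0 ≤ g r η ζ} with hS
  have hcomb : ∀ (a b : ℝ), 0 ≤ a → 0 ≤ b → a + b = 1 → ∀ η η' x y, x ∈ S η → y ∈ S η' →
      a • x + b • y ∈ S (a • η + b • η') := by
    intro a b ha hb hab η η' x y hx hy r
    have := (hg r).2 (Set.mem_univ (η, x)) (Set.mem_univ (η', y)) ha hb hab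
    simp only [Prod.smul_mk, Prod.mk_add_mk, smul_eq_mul] at this
    exact (add_nonneg (mul_nonneg ha (hx r)) (mul_nonneg hb (hy r))).trans this
  have hSm : ∀ η, NullMeasurableSet (S η) := fun η =>
    Convex.nullMeasurableSet volume fun x hx y hy a b ha hb hab => by
      simpa only [← add_smul, hab, one_smul] using hcomb a b ha hb hab η η x y hx hy
  set F : (Fin m → ℝ) → (Fin m → ℝ) → ENNReal :=
    fun η => (S η).indicator fun ζ => ENNReal.ofReal (f ζ) with hF
  have hFm : ∀ η, AEMeasurable (F η) := fun η =>
    hf_int.aemeasurable.ennreal_ofReal.indicator₀ (hSm η)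
  have hint : ∀ η, ∫ ζ in S η, f ζ = (∫⁻ ζ, F η ζ).toReal := fun η => by
    rw [integral_eq_lintegral_of_nonneg_ae (.of_forall hf_nonneg)
      hf_int.aestronglyMeasurable.restrict, lintegral_indicator₀ (hSm η)]
  have hfin : ∀ η, ∫⁻ ζ, F η ζ ≠ ⊤ := fun η => by
    rw [lintegral_indicator₀ (hSm η)]
    exact hf_int.integrableOn.lintegral_lt_top.ne
  rw [hint, hint, hint, ENNReal.toReal_rpow, ENNReal.toReal_rpow, ← ENNReal.toReal_mul]
  refine ENNReal.toReal_mono (hfin _) ?_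
  refine (prekopaLeindler_pi m).lintegral_le h0 h1 (hFm _) (hFm _) (hFm _) fun x y => ?_
  by_cases hx : x ∈ S θ
  swap
  · simp [hF, hx, h0]
  by_cases hy : y ∈ S θ'
  swap
  · simp [hF, hy, h1]
  have hxy := hcomb lam (1 - lam) h0.le h1'.le (by ring) θ θ' x y hx hy
  simp only [hF, Set.indicator_of_mem hx, Set.indicator_of_mem hy, Set.indicator_of_mem hxy]
  rw [ENNReal.ofReal_rpow_of_nonneg (hf_nonneg _) h0.le,
    ENNReal.ofReal_rpow_of_nonneg (hf_nonneg _) h1'.le,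
    ← ENNReal.ofReal_mul (Real.rpow_nonneg (hf_nonneg _) _)]
  exact ENNReal.ofReal_le_ofReal (hf_logconcave x y lam h0.le h1.le)
end
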